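/- Let V be a nonempty type and Eb, Er binary relations on V such that the asymmetric part of the transitive closure of Eb admits no infinite walk and the asymmetric part of the transitive closure of Er admits no infinite walk. Then the collection 𝒮, partially ordered by ≤ = ≤_{Asym(Eb⁺)}, possesses a maximal element: there exists Sm ∈ 𝒮 such that every T ∈ 𝒮 with Sm ≤ T satisfies T = Sm. -/

import Mathlib

/-- The asymmetric part of a binary relation. -/
def Asym {V : Type*} (R : V → V → Prop) : V → V → Prop :=
  fun x y => R x y ∧ ¬ R y x

/-- `f` is an infinite (outward) walk for `R`. -/
def InfWalk {V : Type*} (R : V → V → Prop) (f : ℕ → V) : Prop :=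
  ∀ n : ℕ, R (f n) (f (n + 1))

/-- The monochromatic relation: union of the two transitive closures. -/
def Mono {V : Type*} (Eb Er : V → V → Prop) : V → V → Prop :=
  fun x y => Relation.TransGen Eb x y ∨ Relation.TransGen Er x y

/-- `S` is `R`-independent. -/
def Indep {V : Type*} (R : V → V → Prop) (S : Set V) : Prop :=
  ∀ x ∈ S, ∀ y ∈ S, x = y ∨ ¬ R x y

/-- The order `≤_R` on subsets induced by a relation `R`. -/
def leR {V : Type*} (R : V → V → Prop) (S T : Set V) : Prop :=
  ∀ s ∈ S, ∃ t ∈ T, s = t ∨ R s t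

/-- The collection `𝒮` of nonempty `M`-independent sets `S` such that every
vertex reachable from `S` by a red path reaches `S` by a monochromatic path. -/
def Scal {V : Type*} (Eb Er : V → V → Prop) : Set (Set V) :=
  {S | S.Nonempty ∧ Indep (Mono Eb Er) S ∧
    ∀ y : V, (∃ s ∈ S, Relation.TransGen Er s y) → ∃ s' ∈ S, Mono Eb Er y s'}

/-- The set `S^∞_𝒞` associated to a collection `𝒞` of subsets. -/
def Sinf {V : Type*} (Eb : V → V → Prop) (C : Set (Set V)) : Set V :=
  {s | ∃ S ∈ C, ∀ U ∈ C, leR (Asym (Relation.TransGen Eb)) S U → s ∈ U}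

theorem Asym.trans {V : Type*} {R : V → V → Prop} {x y z : V}
    (hxy : Asym (Relation.TransGen R) x y) (hyz : Asym (Relation.TransGen R) y z) :
    Asym (Relation.TransGen R) x z :=
  ⟨hxy.1.trans hyz.1, fun h => hxy.2 (hyz.1.trans h)⟩

theorem wellFounded_flip_of_not_infWalk {V : Type*} {R : V → V → Prop}
    (h : ¬ ∃ f : ℕ → V, InfWalk R f) : WellFounded (flip R) :=
  wellFounded_iff_isEmpty_descending_chain.2 ⟨fun f => h ⟨f.1, f.2⟩⟩

theorem leR_refl {V : Type*} (R : V → V → Prop) (S : Set V) : leR R S S :=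
  fun s hs => ⟨s, hs, Or.inl rfl⟩

theorem leR_trans {V : Type*} {R : V → V → Prop} {S T U : Set V}
    (hST : leR (Asym (Relation.TransGen R)) S T) (hTU : leR (Asym (Relation.TransGen R)) T U) :
    leR (Asym (Relation.TransGen R)) S U := by
  intro s hs
  obtain ⟨t, ht, hst⟩ := hST s hs
  obtain ⟨u, hu, htu⟩ := hTU t ht
  refine ⟨u, hu, ?_⟩
  rcases hst with rfl | hst
  · exact htu
  · rcases htu with rfl | htu
    · exact Or.inr hst
    · exact Or.inr (hst.trans htu)

theorem subset_of_leR_of_leR {V : Type*} {Eb Er : V → V → Prop} {S T : Set V}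
    (hS : Indep (Mono Eb Er) S) (hST : leR (Asym (Relation.TransGen Eb)) S T)
    (hTS : leR (Asym (Relation.TransGen Eb)) T S) : S ⊆ T := by
  intro s hs
  obtain ⟨t, ht, hst⟩ := hST s hs
  rcases hst with rfl | hst
  · exact ht
  · exfalso
    obtain ⟨u, hu, htu⟩ := hTS t ht
    have hsu : Asym (Relation.TransGen Eb) s u := by
      rcases htu with rfl | htu
      · exact hst
      · exact hst.trans htu
    rcases hS s hs u hu with rfl | h
    · exact hsu.2 hsu.1
    · exact h (Or.inl hsu.1)

theorem Scal_nonempty {V : Type*} [Nonempty V] (Eb Er : V → V → Prop)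
    (hr : ¬ ∃ f : ℕ → V, InfWalk (Asym (Relation.TransGen Er)) f) : (Scal Eb Er).Nonempty := by
  obtain ⟨x, -, hx⟩ := (wellFounded_flip_of_not_infWalk hr).has_min Set.univ Set.univ_nonempty
  refine ⟨{x}, Set.singleton_nonempty x, ?_, ?_⟩
  · rintro a rfl b rfl
    exact Or.inl rfl
  · rintro y ⟨s, rfl, hs⟩
    exact ⟨s, rfl, Or.inr (by_contra fun h => hx y trivial ⟨hs, h⟩)⟩

theorem leR_Sinf {V : Type*} {Eb : V → V → Prop}
    (hb : ¬ ∃ f : ℕ → V, InfWalk (Asym (Relation.TransGen Eb)) f) {C : Set (Set V)} {S : Set V}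
    (hS : S ∈ C) : leR (Asym (Relation.TransGen Eb)) S (Sinf Eb C) := by
  intro s hs
  obtain ⟨t, ⟨⟨T, hT, htT⟩, hst⟩, hmax⟩ := (wellFounded_flip_of_not_infWalk hb).has_min
    {t | (∃ T ∈ C, t ∈ T) ∧ (s = t ∨ Asym (Relation.TransGen Eb) s t)}
    ⟨s, ⟨S, hS, hs⟩, Or.inl rfl⟩
  refine ⟨t, ⟨T, hT, fun U hU hTU => ?_⟩, hst⟩
  obtain ⟨u, hu, htu⟩ := hTU t htT
  rcases htu with rfl | htu
  · exact hu
  · refine absurd htu (hmax u ⟨⟨U, hU, hu⟩, Or.inr ?_⟩)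
    rcases hst with rfl | hst
    · exact htu
    · exact hst.trans htu

theorem Sinf_mem_Scal {V : Type*} {Eb Er : V → V → Prop}
    (hb : ¬ ∃ f : ℕ → V, InfWalk (Asym (Relation.TransGen Eb)) f) {C : Set (Set V)}
    (hC : C ⊆ Scal Eb Er) (hne : C.Nonempty)
    (htot : ∀ S ∈ C, ∀ T ∈ C,
      leR (Asym (Relation.TransGen Eb)) S T ∨ leR (Asym (Relation.TransGen Eb)) T S) :
    Sinf Eb C ∈ Scal Eb Er := by
  refine ⟨?_, ?_, ?_⟩
  · obtain ⟨S, hS⟩ := hne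
    obtain ⟨s, hs⟩ := (hC hS).1
    obtain ⟨t, ht, -⟩ := leR_Sinf hb hS s hs
    exact ⟨t, ht⟩
  · rintro x ⟨S, hS, hx⟩ y ⟨T, hT, hy⟩
    rcases htot S hS T hT with h | h
    · exact (hC hT).2.1 x (hx T hT h) y (hy T hT (leR_refl _ T))
    · exact (hC hS).2.1 x (hx S hS (leR_refl _ S)) y (hy S hS h)
  · rintro y ⟨s, hs, hsy⟩
    obtain ⟨S, hS, hsS⟩ := id hs
    have hsmem := hsS S hS (leR_refl _ S)
    obtain ⟨s', hs', hys' | hys'⟩ := (hC hS).2.2 y ⟨s, hsmem, hsy⟩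
    · obtain ⟨t, ht, hst⟩ := leR_Sinf hb hS s' hs'
      rcases hst with rfl | hst
      · exact ⟨s', ht, Or.inl hys'⟩
      · exact ⟨t, ht, Or.inl (hys'.trans hst.1)⟩
    · rcases (hC hS).2.1 s hsmem s' hs' with rfl | h
      · exact ⟨s, hs, Or.inr hys'⟩
      · exact absurd (Or.inr (hsy.trans hys')) h

theorem stmt8 {V : Type*} [Nonempty V] (Eb Er : V → V → Prop)
    (hb : ¬ ∃ f : ℕ → V, InfWalk (Asym (Relation.TransGen Eb)) f)
    (hr : ¬ ∃ f : ℕ → V, InfWalk (Asym (Relation.TransGen Er)) f) :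
    ∃ Sm ∈ Scal Eb Er, ∀ T ∈ Scal Eb Er,
      leR (Asym (Relation.TransGen Eb)) Sm T → T = Sm := by
  obtain ⟨S₀, hS₀⟩ := Scal_nonempty Eb Er hr
  obtain ⟨⟨Sm, hSm⟩, hmax⟩ := exists_maximal_of_chains_bounded
    (r := fun S T : Scal Eb Er => leR (Asym (Relation.TransGen Eb)) S.1 T.1)
    (fun c hc => by
      rcases c.eq_empty_or_nonempty with rfl | hne
      · exact ⟨⟨S₀, hS₀⟩, fun a ha => ha.elim⟩
      · refine ⟨⟨Sinf Eb (Subtype.val '' c), Sinf_mem_Scal hb ?_ (hne.image _) ?_⟩,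
          fun a ha => leR_Sinf hb ⟨a, ha, rfl⟩⟩
        · rintro _ ⟨S, -, rfl⟩
          exact S.2
        · rintro _ ⟨S, hS, rfl⟩ _ ⟨T, hT, rfl⟩
          by_cases h : S = T
          · exact Or.inl (h ▸ leR_refl _ _)
          · exact hc hS hT h)
    leR_trans
  refine ⟨Sm, hSm, fun T hT hle => ?_⟩
  have hge : leR (Asym (Relation.TransGen Eb)) T Sm := hmax ⟨T, hT⟩ hle
  exact (subset_of_leR_of_leR hT.2.1 hge hle).antisymm (subset_of_leR_of_leR hSm.2.1 hle hge)
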